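/- In the rounding process with LP-feasible x, for every late edge (i,t) (so that the conditioning event below has positive probability), P[O_{i,t} | A_t = 1, I¹_t ≠ i, U₁(t)] ≤ P[O_{i,t}] · (1 + 12c/(1/2 − c)²). -/

import Mathlib

open Finset

noncomputable section
open scoped Classical

namespace Rounding

/-- A configuration of all the randomness used by the rounding process: arrival
indicators `A_t`, first picks `I¹_t`, second picks `I²_t`, and acceptance coins
`Y_{i,t}`. -/
abbrev Cfg (m n : ℕ) :=
  (Fin n → Bool) × (Fin n → Fin m) × (Fin n → Fin m) × (Fin m → Fin n → Bool)

/-- The constant `c = 1/100`. -/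
def c : ℝ := 1 / 100

variable (m n : ℕ)

/-- `S x i t = ∑_{t' < t} x i t'`. -/
def S (x : Fin m → Fin n → ℝ) (i : Fin m) (t : Fin n) : ℝ :=
  ∑ t' ∈ Finset.univ.filter fun t' : Fin n => t' < t, x i t'

/-- LP-feasibility of `x` (with arrival probabilities `p t ∈ (0,1]`, every
constraint `∑_i x i t = p t` tight). -/
def LPFeasible (p : Fin n → ℝ) (x : Fin m → Fin n → ℝ) : Prop :=
  (∀ t, 0 < p t ∧ p t ≤ 1) ∧
  (∀ i t, 0 ≤ x i t) ∧
  (∀ i, ∑ t, x i t ≤ 1) ∧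
  (∀ t, ∑ i, x i t = p t) ∧
  (∀ i t, x i t ≤ p t * (1 - S m n x i t))

/-- Edge `(i,t)` is early if `∑_{t' < t} x i t' ≤ (1/2 − c)/(1/2 + c)`. -/
def Early (x : Fin m → Fin n → ℝ) (i : Fin m) (t : Fin n) : Prop :=
  S m n x i t ≤ (1/2 - c) / (1/2 + c)

/-- Edge `(i,t)` is late if it is not early. -/
def Late (x : Fin m → Fin n → ℝ) (i : Fin m) (t : Fin n) : Prop :=
  ¬ Early m n x i t

/-- The acceptance probability `q_{i,t}`. -/
def q (x : Fin m → Fin n → ℝ) (i : Fin m) (t : Fin n) : ℝ :=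
  min 1 ((1/2 + c) / (1 - (1/2 + c) * S m n x i t))

/-- The probability of a configuration: the product of the probabilities of all
the mutually independent components (`P(A_t = 1) = p_t`,
`P(I¹_t = i) = P(I²_t = i) = x_{i,t}/p_t`, `P(Y_{i,t} = 1) = q_{i,t}`). -/
def weight (p : Fin n → ℝ) (x : Fin m → Fin n → ℝ) (cfg : Cfg m n) : ℝ :=
  (∏ t, if cfg.1 t then p t else 1 - p t) *
  (∏ t, x (cfg.2.1 t) t / p t) *
  (∏ t, x (cfg.2.2.1 t) t / p t) *
  ∏ i, ∏ t, if cfg.2.2.2 i t then q m n x i t else 1 - q m n x i t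

/-- Probability of an event. -/
def Pr (p : Fin n → ℝ) (x : Fin m → Fin n → ℝ) (E : Set (Cfg m n)) : ℝ :=
  ∑ cfg : Cfg m n, if cfg ∈ E then weight m n p x cfg else 0

/-- Conditional probability of `E` given `F`. -/
def condPr (p : Fin n → ℝ) (x : Fin m → Fin n → ℝ) (E F : Set (Cfg m n)) : ℝ :=
  Pr m n p x (E ∩ F) / Pr m n p x F

/-- Bin `i` is unmatched in the partial matching `M`. -/
def FreeBin (M : Finset (Fin m × Fin n)) (i : Fin m) : Prop :=
  ∀ t, (i, t) ∉ M

/-- `proc x cfg t = (M₁, M₂)`: the two parts of the matching built by the rounding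
process after processing all times `< t`.  At each time `t`, if ball `t` arrives,
its first pick `I¹_t` is unmatched, and the coin `Y_{I¹_t,t}` comes up heads, then
`(I¹_t, t)` is added to `M₁`; otherwise, if ball `t` arrives, its second pick
`I²_t` is unmatched, and edge `(I²_t, t)` is late, then `(I²_t, t)` is added
to `M₂`. -/
def proc (x : Fin m → Fin n → ℝ) (cfg : Cfg m n) :
    ℕ → Finset (Fin m × Fin n) × Finset (Fin m × Fin n)
  | 0 => (∅, ∅)
  | (t + 1) =>
    let P := proc x cfg t
    if h : t < n then
      let T : Fin n := ⟨t, h⟩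
      let M := P.1 ∪ P.2
      if cfg.1 T = true ∧ FreeBin m n M (cfg.2.1 T) ∧ cfg.2.2.2 (cfg.2.1 T) T = true then
        (insert (cfg.2.1 T, T) P.1, P.2)
      else if cfg.1 T = true ∧ FreeBin m n M (cfg.2.2.1 T) ∧ Late m n x (cfg.2.2.1 T) T then
        (P.1, insert (cfg.2.2.1 T, T) P.2)
      else P
    else P

/-- The final matching `M₁` (edges matched on a first pick). -/
def M1F (x : Fin m → Fin n → ℝ) (cfg : Cfg m n) : Finset (Fin m × Fin n) :=
  (proc m n x cfg n).1

/-- The final matching `M₂` (edges matched on a second pick). -/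
def M2F (x : Fin m → Fin n → ℝ) (cfg : Cfg m n) : Finset (Fin m × Fin n) :=
  (proc m n x cfg n).2

/-- The final matching `M = M₁ ∪ M₂`. -/
def MF (x : Fin m → Fin n → ℝ) (cfg : Cfg m n) : Finset (Fin m × Fin n) :=
  M1F m n x cfg ∪ M2F m n x cfg

/-- `V_{i,t}`: the event that bin `i` is unmatched before time `t`. -/
def V (x : Fin m → Fin n → ℝ) (i : Fin m) (t : Fin n) : Set (Cfg m n) :=
  {cfg | FreeBin m n ((proc m n x cfg t.1).1 ∪ (proc m n x cfg t.1).2) i}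

/-- `O_{i,t}`: the event that bin `i` is matched before time `t`. -/
def O (x : Fin m → Fin n → ℝ) (i : Fin m) (t : Fin n) : Set (Cfg m n) :=
  (V m n x i t)ᶜ

/-- `O^E_{i,t}`: the event that bin `i` is matched along an early edge before time `t`. -/
def OE (x : Fin m → Fin n → ℝ) (i : Fin m) (t : Fin n) : Set (Cfg m n) :=
  {cfg | ∃ t' : Fin n, Early m n x i t' ∧
    (i, t') ∈ (proc m n x cfg t.1).1 ∪ (proc m n x cfg t.1).2}

/-- `O^L_{i,t}`: the event that bin `i` is matched along a late edge before time `t`. -/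
def OL (x : Fin m → Fin n → ℝ) (i : Fin m) (t : Fin n) : Set (Cfg m n) :=
  {cfg | ∃ t' : Fin n, Late m n x i t' ∧
    (i, t') ∈ (proc m n x cfg t.1).1 ∪ (proc m n x cfg t.1).2}

/-- `U₁(t)`: the event that ball `t` is not matched in the first-pick step at time `t`. -/
def U1 (x : Fin m → Fin n → ℝ) (t : Fin n) : Set (Cfg m n) :=
  {cfg | ∀ i, (i, t) ∉ (proc m n x cfg (t.1 + 1)).1}

/-- The event that ball `t` arrives (`A_t = 1`). -/
def EvA (t : Fin n) : Set (Cfg m n) := {cfg | cfg.1 t = true}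

/-- The event that the first pick of ball `t` is bin `j` (`I¹_t = j`). -/
def EvI1 (j : Fin m) (t : Fin n) : Set (Cfg m n) := {cfg | cfg.2.1 t = j}


section Slices

variable {m n}

/-- The randomness of a single time step: arrival, first pick, second pick, coins. -/
abbrev Slice (m : ℕ) := Bool × Fin m × Fin m × (Fin m → Bool)

/-- A configuration is a family of independent time steps. -/
def sliceEquiv : Cfg m n ≃ (Fin n → Slice m) where
  toFun cfg s := (cfg.1 s, cfg.2.1 s, cfg.2.2.1 s, fun k => cfg.2.2.2 k s)
  invFun f := (fun s => (f s).1, fun s => (f s).2.1, fun s => (f s).2.2.1,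
    fun k s => (f s).2.2.2 k)
  left_inv _ := rfl
  right_inv _ := rfl

/-- The probability of one time step. -/
def sliceWeight (p : Fin n → ℝ) (x : Fin m → Fin n → ℝ) (s : Fin n) (σ : Slice m) : ℝ :=
  (if σ.1 then p s else 1 - p s) * (x σ.2.1 s / p s) * (x σ.2.2.1 s / p s) *
    ∏ k, if σ.2.2.2 k then q m n x k s else 1 - q m n x k s

/-- Expectation over a single time step. -/
def sliceMean (p : Fin n → ℝ) (x : Fin m → Fin n → ℝ) (s : Fin n) (f : Slice m → ℝ) : ℝ :=
  ∑ σ, sliceWeight p x s σ * f σ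

/-- Expectation over all configurations. -/
def mean (p : Fin n → ℝ) (x : Fin m → Fin n → ℝ) (f : Cfg m n → ℝ) : ℝ :=
  ∑ cfg, weight m n p x cfg * f cfg

variable {p : Fin n → ℝ} {x : Fin m → Fin n → ℝ}

lemma weight_eq_prod (cfg : Cfg m n) :
    weight m n p x cfg = ∏ s, sliceWeight p x s (sliceEquiv cfg s) := by
  simp only [weight, sliceWeight, sliceEquiv, Equiv.coe_fn_mk, prod_mul_distrib]
  congr 1
  exact prod_comm

lemma mean_prod (f : Fin n → Slice m → ℝ) :
    mean p x (fun cfg => ∏ s, f s (sliceEquiv cfg s)) = ∏ s, sliceMean p x s (f s) := by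
  simp only [mean, sliceMean, weight_eq_prod, ← prod_mul_distrib]
  rw [Equiv.sum_comp sliceEquiv
    (fun g : Fin n → Slice m => ∏ s, sliceWeight p x s (g s) * f s (g s)),
    prod_univ_sum, Fintype.piFinset_univ]

lemma mean_add (f g : Cfg m n → ℝ) :
    mean p x (fun cfg => f cfg + g cfg) = mean p x f + mean p x g := by
  simp [mean, mul_add, sum_add_distrib]

lemma mean_sub (f g : Cfg m n → ℝ) :
    mean p x (fun cfg => f cfg - g cfg) = mean p x f - mean p x g := by
  simp [mean, mul_sub, sum_sub_distrib]

lemma mean_sum {ι : Type*} (A : Finset ι) (f : ι → Cfg m n → ℝ) :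
    mean p x (fun cfg => ∑ a ∈ A, f a cfg) = ∑ a ∈ A, mean p x (f a) := by
  simp only [mean, mul_sum]
  exact sum_comm

lemma Pr_eq_mean (E : Set (Cfg m n)) [DecidablePred (· ∈ E)] :
    Pr m n p x E = mean p x (fun cfg => if cfg ∈ E then 1 else 0) := by
  refine sum_congr rfl fun cfg _ => ?_
  by_cases h : cfg ∈ E <;> simp [h]

lemma sliceMean_sub (s : Fin n) (f g : Slice m → ℝ) :
    sliceMean p x s (fun σ => f σ - g σ) = sliceMean p x s f - sliceMean p x s g := by
  simp [sliceMean, mul_sub, sum_sub_distrib]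

lemma sliceMean_mul (s : Fin n) (f : Bool → ℝ) (g h : Fin m → ℝ) (r : Fin m → Bool → ℝ) :
    sliceMean p x s (fun σ => f σ.1 * g σ.2.1 * h σ.2.2.1 * ∏ k, r k (σ.2.2.2 k)) =
      (p s * f true + (1 - p s) * f false) * (∑ k, x k s / p s * g k) *
        (∑ k, x k s / p s * h k) *
        ∏ k, (q m n x k s * r k true + (1 - q m n x k s) * r k false) := by
  have hy : ∏ k, (q m n x k s * r k true + (1 - q m n x k s) * r k false) =
      ∑ y : Fin m → Bool, ∏ k, (if y k then q m n x k s else 1 - q m n x k s) * r k (y k) := by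
    rw [← Fintype.piFinset_univ, ← prod_univ_sum (fun _ => univ)
      (fun k b => (if b = true then q m n x k s else 1 - q m n x k s) * r k b)]
    simp
  have ha : p s * f true + (1 - p s) * f false =
      ∑ a : Bool, (if a then p s else 1 - p s) * f a := by simp
  rw [hy, ha]
  simp only [sliceMean, sliceWeight, Fintype.sum_prod_type, prod_mul_distrib]
  rw [mul_assoc, mul_assoc, sum_mul]
  refine sum_congr rfl fun _ _ => ?_
  rw [← mul_assoc, mul_sum, sum_mul]
  refine sum_congr rfl fun _ _ => ?_
  rw [sum_mul_sum, mul_sum]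
  refine sum_congr rfl fun _ _ => ?_
  rw [mul_sum]
  refine sum_congr rfl fun _ _ => ?_
  ring

/-- Indicator that the ball arrives and its first pick is `k`. -/
def firstPick (k : Fin m) (σ : Slice m) : ℝ :=
  (if σ.1 = true then 1 else 0) * (if σ.2.1 = k then 1 else 0)

/-- Indicator that the ball arrives and its second pick is `k`. -/
def secondPick (k : Fin m) (σ : Slice m) : ℝ :=
  (if σ.1 = true then 1 else 0) * (if σ.2.2.1 = k then 1 else 0)

/-- Indicator that the ball arrives, first-picks `k`, and the coin of `k` accepts. -/
def hit (k : Fin m) (σ : Slice m) : ℝ :=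
  firstPick k σ * (if σ.2.2.2 k = true then 1 else 0)

lemma hit_eq (k : Fin m) (σ : Slice m) :
    hit k σ = if σ.1 = true ∧ σ.2.1 = k ∧ σ.2.2.2 k = true then 1 else 0 := by
  unfold hit firstPick
  split_ifs <;> simp_all

lemma hit_mul_hit {k l : Fin m} (hkl : k ≠ l) (σ : Slice m) : hit k σ * hit l σ = 0 := by
  simp only [hit_eq]
  split_ifs <;> simp_all

lemma hit_nonneg (k : Fin m) (σ : Slice m) : 0 ≤ hit k σ := by
  rw [hit_eq]; split_ifs <;> simp

lemma hit_le_one (k : Fin m) (σ : Slice m) : hit k σ ≤ 1 := by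
  rw [hit_eq]; split_ifs <;> simp

lemma LPFeasible.sum_div (hx : LPFeasible m n p x) (s : Fin n) : ∑ k, x k s / p s = 1 := by
  rw [← Finset.sum_div, hx.2.2.2.1 s, div_self (hx.1 s).1.ne']

lemma LPFeasible.S_le_one (hx : LPFeasible m n p x) (k : Fin m) (s : Fin n) :
    S m n x k s ≤ 1 :=
  (sum_le_sum_of_subset_of_nonneg (filter_subset _ _) fun _ _ _ => hx.2.1 _ _).trans (hx.2.2.1 k)

lemma LPFeasible.S_mono (hx : LPFeasible m n p x) (k : Fin m) {s t : Fin n} (hst : s ≤ t) :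
    S m n x k s ≤ S m n x k t :=
  sum_le_sum_of_subset_of_nonneg
    (fun _ hr => by simp only [mem_filter, mem_univ, true_and] at hr ⊢; exact hr.trans_le hst)
    fun _ _ _ => hx.2.1 _ _

lemma LPFeasible.early_of_le (hx : LPFeasible m n p x) {k : Fin m} {s t : Fin n} (hst : s ≤ t)
    (ht : Early m n x k t) : Early m n x k s :=
  (hx.S_mono k hst).trans ht

lemma q_le_one (k : Fin m) (s : Fin n) : q m n x k s ≤ 1 := min_le_left _ _

lemma LPFeasible.q_nonneg (hx : LPFeasible m n p x) (k : Fin m) (s : Fin n) :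
    0 ≤ q m n x k s := by
  have := hx.S_le_one k s
  refine le_min zero_le_one (div_nonneg ?_ ?_) <;> norm_num [c]
  linarith

lemma LPFeasible.sliceWeight_nonneg (hx : LPFeasible m n p x) (s : Fin n) (σ : Slice m) :
    0 ≤ sliceWeight p x s σ := by
  obtain ⟨hp, hp'⟩ := hx.1 s
  refine mul_nonneg (mul_nonneg (mul_nonneg ?_ (div_nonneg (hx.2.1 _ _) hp.le))
    (div_nonneg (hx.2.1 _ _) hp.le)) (prod_nonneg fun k _ => ?_)
  · split_ifs <;> linarith
  · have := hx.q_nonneg k s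
    have := q_le_one (x := x) k s
    split_ifs <;> linarith

lemma LPFeasible.mean_mono (hx : LPFeasible m n p x) {f g : Cfg m n → ℝ}
    (h : ∀ cfg, f cfg ≤ g cfg) : mean p x f ≤ mean p x g :=
  sum_le_sum fun cfg _ => mul_le_mul_of_nonneg_left (h cfg)
    (by rw [weight_eq_prod]; exact prod_nonneg fun _ _ => hx.sliceWeight_nonneg _ _)

lemma LPFeasible.sliceMean_nonneg (hx : LPFeasible m n p x) (s : Fin n) {f : Slice m → ℝ}
    (h : ∀ σ, 0 ≤ f σ) : 0 ≤ sliceMean p x s f :=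
  sum_nonneg fun σ _ => mul_nonneg (hx.sliceWeight_nonneg s σ) (h σ)

lemma LPFeasible.sliceMean_one (hx : LPFeasible m n p x) (s : Fin n) :
    sliceMean p x s (fun _ => 1) = 1 := by
  have h := sliceMean_mul (p := p) (x := x) s (fun _ => 1) (fun _ => 1) (fun _ => 1)
    (fun _ _ => 1)
  simpa [hx.sum_div s] using h

lemma LPFeasible.sliceMean_firstPick (hx : LPFeasible m n p x) (s : Fin n) (k : Fin m) :
    sliceMean p x s (firstPick k) = x k s := by
  have h := sliceMean_mul (p := p) (x := x) s (fun a => if a = true then 1 else 0)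
    (fun l => if l = k then 1 else 0) (fun _ => 1) (fun _ _ => 1)
  simp only [prod_const_one, mul_one, hx.sum_div s] at h
  simp only [Bool.false_eq_true, if_false, mul_one, mul_zero, add_zero, mul_ite,
    sum_ite_eq', mem_univ, if_pos, add_sub_cancel, prod_const_one,
    mul_div_cancel₀ _ (hx.1 s).1.ne'] at h
  rw [← h]
  refine congrArg _ (funext fun σ => ?_)
  simp [firstPick]

lemma LPFeasible.sliceMean_secondPick (hx : LPFeasible m n p x) (s : Fin n) (k : Fin m) :
    sliceMean p x s (secondPick k) = x k s := by
  have h := sliceMean_mul (p := p) (x := x) s (fun a => if a = true then 1 else 0)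
    (fun _ => 1) (fun l => if l = k then 1 else 0) (fun _ _ => 1)
  simp only [prod_const_one, mul_one, hx.sum_div s] at h
  simp only [Bool.false_eq_true, if_false, mul_one, mul_zero, add_zero, mul_ite,
    sum_ite_eq', mem_univ, if_pos, add_sub_cancel, prod_const_one,
    mul_div_cancel₀ _ (hx.1 s).1.ne'] at h
  rw [← h]
  refine congrArg _ (funext fun σ => ?_)
  simp [secondPick]

lemma LPFeasible.sliceMean_hit (hx : LPFeasible m n p x) (s : Fin n) (k : Fin m) :
    sliceMean p x s (hit k) = x k s * q m n x k s := by
  have h := sliceMean_mul (p := p) (x := x) s (fun a => if a = true then 1 else 0)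
    (fun l => if l = k then 1 else 0) (fun _ => 1)
    (fun l b => if l = k then (if b = true then 1 else 0) else 1)
  have hq : ∀ l, (q m n x l s * (if l = k then (1 : ℝ) else 1) +
      (1 - q m n x l s) * (if l = k then 0 else 1)) = if l = k then q m n x l s else 1 := by
    intro l; split_ifs <;> ring
  simp only [if_true, Bool.false_eq_true, if_false] at h
  simp only [hq] at h
  simp only [prod_ite_eq', mem_univ, if_true, hx.sum_div s, mul_one, mul_zero, add_zero,
    mul_ite, sum_ite_eq', mul_div_cancel₀ _ (hx.1 s).1.ne'] at h
  rw [← h]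
  refine congrArg _ (funext fun σ => ?_)
  simp [hit, firstPick]

/-- Indicator that step `s` does not match `k` along an early first pick before time `t`. -/
def avoidsEarly (x : Fin m → Fin n → ℝ) (t : Fin n) (k : Fin m) (s : Fin n) (σ : Slice m) : ℝ :=
  if s < t ∧ Early m n x k s then 1 - hit k σ else 1

/-- Indicator that `k` is not matched along an early edge before time `t`. -/
def earlyFree (x : Fin m → Fin n → ℝ) (t : Fin n) (k : Fin m) (cfg : Cfg m n) : ℝ :=
  ∏ s, avoidsEarly x t k s (sliceEquiv cfg s)

/-- Probability that `k` is not matched along an early edge before time `t`. -/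
def earlyFreeProb (p : Fin n → ℝ) (x : Fin m → Fin n → ℝ) (t : Fin n) (k : Fin m) : ℝ :=
  ∏ s, sliceMean p x s (avoidsEarly x t k s)

/-- Mass of the early edges of `k` before time `t`. -/
def earlyMass (x : Fin m → Fin n → ℝ) (t : Fin n) (k : Fin m) : ℝ :=
  ∑ s with s < t ∧ Early m n x k s, x k s

lemma avoidsEarly_nonneg (t : Fin n) (k : Fin m) (s : Fin n) (σ : Slice m) :
    0 ≤ avoidsEarly x t k s σ := by
  unfold avoidsEarly
  have := hit_le_one k σ
  split_ifs <;> linarith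

lemma LPFeasible.sliceMean_avoidsEarly (hx : LPFeasible m n p x) (t : Fin n) (k : Fin m)
    (s : Fin n) : sliceMean p x s (avoidsEarly x t k s) =
      if s < t ∧ Early m n x k s then 1 - x k s * q m n x k s else 1 := by
  unfold avoidsEarly
  split_ifs
  · rw [sliceMean_sub, hx.sliceMean_one, hx.sliceMean_hit]
  · exact hx.sliceMean_one s

lemma LPFeasible.sliceMean_avoidsEarly_mul_le (hx : LPFeasible m n p x) (t : Fin n)
    {k l : Fin m} (hkl : k ≠ l) (s : Fin n) :
    sliceMean p x s (fun σ => avoidsEarly x t k s σ * avoidsEarly x t l s σ) ≤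
      sliceMean p x s (avoidsEarly x t k s) * sliceMean p x s (avoidsEarly x t l s) := by
  by_cases hk : s < t ∧ Early m n x k s
  · by_cases hl : s < t ∧ Early m n x l s
    · have h : ∀ σ, (1 - hit k σ) * (1 - hit l σ) = 1 - hit k σ - hit l σ := fun σ => by
        linear_combination hit_mul_hit hkl σ
      rw [hx.sliceMean_avoidsEarly, hx.sliceMean_avoidsEarly]
      simp only [avoidsEarly, if_pos hk, if_pos hl, h]
      rw [sliceMean_sub, sliceMean_sub, hx.sliceMean_one, hx.sliceMean_hit, hx.sliceMean_hit]
      nlinarith [mul_nonneg (mul_nonneg (hx.2.1 k s) (hx.q_nonneg k s))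
        (mul_nonneg (hx.2.1 l s) (hx.q_nonneg l s))]
    · have h : avoidsEarly x t l s = fun _ => 1 := funext fun _ => if_neg hl
      simp [h, hx.sliceMean_one]
  · have h : avoidsEarly x t k s = fun _ => 1 := funext fun _ => if_neg hk
    simp [h, hx.sliceMean_one]

lemma LPFeasible.q_mul_of_early (hx : LPFeasible m n p x) {k : Fin m} {s : Fin n}
    (h : Early m n x k s) : q m n x k s * (1 - (1 / 2 + c) * S m n x k s) = 1 / 2 + c := by
  have h1 := hx.S_le_one k s
  unfold Early at h
  unfold q
  have hpos : 0 < 1 - (1 / 2 + c) * S m n x k s := by norm_num [c]; linarith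
  rw [min_eq_right, div_mul_cancel₀ _ hpos.ne']
  rw [div_le_one hpos]
  norm_num [c] at *
  linarith

lemma LPFeasible.earlyFreeProb_eq (hx : LPFeasible m n p x) (t : Fin n) (k : Fin m) :
    earlyFreeProb p x t k = 1 - (1 / 2 + c) * earlyMass x t k := by
  have key : ∀ u ≤ n, ∏ s : Fin n with s.1 < u,
      (if s < t ∧ Early m n x k s then 1 - x k s * q m n x k s else 1) =
      1 - (1 / 2 + c) * ∑ s : Fin n with s.1 < u,
        if s < t ∧ Early m n x k s then x k s else 0 := by
    intro u
    induction u with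
    | zero => simp
    | succ u ih =>
      intro hu
      have hins : (univ.filter fun s : Fin n => s.1 < u + 1) =
          insert ⟨u, hu⟩ (univ.filter fun s : Fin n => s.1 < u) := by
        ext s
        simp only [mem_filter, mem_univ, true_and, mem_insert, Fin.ext_iff]
        omega
      rw [hins, prod_insert (by simp), sum_insert (by simp), ih (by omega)]
      split_ifs with h
      · have hS : ∑ s : Fin n with s.1 < u, (if s < t ∧ Early m n x k s then x k s else 0) =
            S m n x k ⟨u, hu⟩ := by
          refine sum_congr (by ext s; simp [Fin.lt_def]) fun s hs => if_pos ?_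
          simp only [mem_filter, mem_univ, true_and] at hs
          exact ⟨lt_trans (Fin.lt_def.2 hs) h.1, hx.early_of_le (Fin.le_def.2 hs.le) h.2⟩
        rw [hS]
        linear_combination -x k ⟨u, hu⟩ * hx.q_mul_of_early h.2
      · ring
  have h := key n le_rfl
  simp only [Fin.is_lt, filter_true] at h
  simp only [earlyFreeProb, hx.sliceMean_avoidsEarly, h, earlyMass, sum_filter]

lemma LPFeasible.le_earlyMass (hx : LPFeasible m n p x) {k : Fin m} {s t : Fin n} (hst : s ≤ t)
    (hs : Late m n x k s) : (1 / 2 - c) / (1 / 2 + c) ≤ earlyMass x t k := by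
  obtain ⟨r, hr, hmin⟩ := wellFounded_lt.has_min {r : Fin n | Late m n x k r} ⟨s, hs⟩
  have hrt : r ≤ t := (not_lt.1 (hmin s hs)).trans hst
  refine (not_le.1 hr).le.trans (sum_le_sum_of_subset_of_nonneg ?_ fun _ _ _ => hx.2.1 _ _)
  intro u hu
  simp only [mem_filter, mem_univ, true_and] at hu ⊢
  exact ⟨hu.trans_le hrt, not_not.1 fun h => hmin u h hu⟩

lemma earlyMass_add_late (t : Fin n) (k : Fin m) :
    earlyMass x t k + ∑ s with s < t ∧ Late m n x k s, x k s = S m n x k t := by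
  simp only [earlyMass, S, sum_filter]
  rw [← sum_add_distrib]
  refine sum_congr rfl fun s _ => ?_
  by_cases h : s < t <;> by_cases h' : Early m n x k s <;> simp [h, h', Late]

lemma LPFeasible.earlyMass_of_early (hx : LPFeasible m n p x) {t : Fin n} {k : Fin m}
    (h : Early m n x k t) : earlyMass x t k = S m n x k t :=
  sum_congr (by
    ext s
    simp only [mem_filter, mem_univ, true_and, and_iff_left_iff_imp]
    exact fun hs => hx.early_of_le hs.le h) fun _ _ => rfl

lemma LPFeasible.earlyFreeProb_le_of_late (hx : LPFeasible m n p x) {k : Fin m} {s t : Fin n}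
    (hst : s ≤ t) (hs : Late m n x k s) : earlyFreeProb p x t k ≤ 1 / 2 + c := by
  have := hx.le_earlyMass hst hs
  rw [hx.earlyFreeProb_eq]
  norm_num [c] at *
  linarith

lemma LPFeasible.earlyFreeProb_nonneg (hx : LPFeasible m n p x) (t : Fin n) (k : Fin m) :
    0 ≤ earlyFreeProb p x t k :=
  prod_nonneg fun s _ => hx.sliceMean_nonneg s (avoidsEarly_nonneg t k s)

lemma LPFeasible.q_mul_earlyFreeProb_le (hx : LPFeasible m n p x) (t : Fin n) (k : Fin m) :
    q m n x k t * earlyFreeProb p x t k ≤ 1 / 2 + c := by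
  by_cases h : Early m n x k t
  · rw [hx.earlyFreeProb_eq, hx.earlyMass_of_early h, hx.q_mul_of_early h]
  · exact (mul_le_of_le_one_left (hx.earlyFreeProb_nonneg t k) (q_le_one k t)).trans
      (hx.earlyFreeProb_le_of_late le_rfl h)

lemma LPFeasible.earlyFreeProb_mul_late_le (hx : LPFeasible m n p x) (t : Fin n) (k : Fin m) :
    earlyFreeProb p x t k * ∑ s with s < t ∧ Late m n x k s, x k s ≤ 2 * c := by
  have h0 : 0 ≤ ∑ s with s < t ∧ Late m n x k s, x k s := sum_nonneg fun _ _ => hx.2.1 _ _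
  by_cases h : ∃ s < t, Late m n x k s
  · obtain ⟨s, hs, hl⟩ := h
    have h1 := hx.earlyFreeProb_le_of_late hs.le hl
    have h2 := hx.le_earlyMass hs.le hl
    have h3 := earlyMass_add_late (x := x) t k
    have h4 := hx.S_le_one k t
    refine (mul_le_mul_of_nonneg_right h1 h0).trans ?_
    norm_num [c] at *
    linarith
  · rw [filter_false_of_mem fun s _ hs => h ⟨s, hs.1, hs.2⟩]
    norm_num [c]

lemma prod_update_eq_mul {β : Type*} (v : Fin n → β → ℝ) (G : Fin n → β) (t : Fin n) (b : β)
    (h : v t (G t) = 1) : ∏ s, v s (Function.update G t b s) = v t b * ∏ s, v s (G s) := by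
  rw [← mul_prod_erase univ _ (mem_univ t), ← mul_prod_erase univ (fun s => v s (G s)) (mem_univ t),
    h, one_mul, Function.update_self]
  congr 1
  exact prod_congr rfl fun s hs => by rw [Function.update_of_ne (ne_of_mem_erase hs)]

lemma LPFeasible.mean_mul_prod (hx : LPFeasible m n p x) (f : Slice m → ℝ)
    (G : Fin n → Slice m → ℝ) (t : Fin n) (hG : G t = fun _ => 1) :
    mean p x (fun cfg => f (sliceEquiv cfg t) * ∏ s, G s (sliceEquiv cfg s)) =
      sliceMean p x t f * ∏ s, sliceMean p x s (G s) := by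
  rw [← prod_update_eq_mul (fun s => sliceMean p x s) G t f (by rw [hG, hx.sliceMean_one]),
    ← mean_prod]
  refine congrArg _ (funext fun cfg => ?_)
  rw [prod_update_eq_mul (fun s (g : Slice m → ℝ) => g (sliceEquiv cfg s)) G t f (by rw [hG])]

lemma LPFeasible.mean_mul_mul_prod (hx : LPFeasible m n p x) (f g : Slice m → ℝ)
    (G : Fin n → Slice m → ℝ) {t r : Fin n} (hrt : r ≠ t) (hG : G t = fun _ => 1)
    (hG' : G r = fun _ => 1) :
    mean p x (fun cfg => f (sliceEquiv cfg t) *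
        (g (sliceEquiv cfg r) * ∏ s, G s (sliceEquiv cfg s))) =
      sliceMean p x t f * (sliceMean p x r g * ∏ s, sliceMean p x s (G s)) := by
  have h := hx.mean_mul_prod f (Function.update G r g) t
    (by rw [Function.update_of_ne hrt.symm, hG])
  rw [prod_update_eq_mul (fun s => sliceMean p x s) G r g (by rw [hG', hx.sliceMean_one])] at h
  rw [← h]
  refine congrArg _ (funext fun cfg => ?_)
  rw [prod_update_eq_mul (fun s (g : Slice m → ℝ) => g (sliceEquiv cfg s)) G r g (by rw [hG'])]

lemma avoidsEarly_self (t : Fin n) (k : Fin m) : avoidsEarly x t k t = fun _ => 1 :=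
  funext fun _ => if_neg fun h => lt_irrefl _ h.1

lemma avoidsEarly_of_late (t : Fin n) {k : Fin m} {s : Fin n} (h : Late m n x k s) :
    avoidsEarly x t k s = fun _ => 1 :=
  funext fun _ => if_neg fun h' => h h'.2

/-- If `k` is not matched along an early edge, the number of its late picks before `t`. -/
def latePicks (x : Fin m → Fin n → ℝ) (t : Fin n) (k : Fin m) (cfg : Cfg m n) : ℝ :=
  ∑ s with s < t ∧ Late m n x k s,
    (firstPick k (sliceEquiv cfg s) + secondPick k (sliceEquiv cfg s)) * earlyFree x t k cfg

lemma LPFeasible.mean_mul_latePicks_le (hx : LPFeasible m n p x) (t : Fin n) (j k : Fin m) :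
    mean p x (fun cfg => firstPick j (sliceEquiv cfg t) * latePicks x t k cfg) ≤
      x j t * (4 * c) := by
  have hpick : ∀ s, sliceMean p x s (fun σ => firstPick k σ + secondPick k σ) = 2 * x k s := by
    intro s
    have := hx.sliceMean_firstPick s k
    have := hx.sliceMean_secondPick s k
    simp only [sliceMean, mul_add, sum_add_distrib] at *
    linarith
  have h : mean p x (fun cfg => firstPick j (sliceEquiv cfg t) * latePicks x t k cfg) =
      ∑ s with s < t ∧ Late m n x k s, x j t * (2 * x k s * earlyFreeProb p x t k) := by
    simp only [latePicks, mul_sum]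
    rw [mean_sum]
    refine sum_congr rfl fun s hs => ?_
    simp only [mem_filter, mem_univ, true_and] at hs
    have := hx.mean_mul_mul_prod (firstPick j) (fun σ => firstPick k σ + secondPick k σ)
      (avoidsEarly x t k) hs.1.ne (avoidsEarly_self t k) (avoidsEarly_of_late t hs.2)
    rw [hpick, hx.sliceMean_firstPick] at this
    exact this
  rw [h, ← mul_sum, ← sum_mul, ← mul_sum]
  refine mul_le_mul_of_nonneg_left ?_ (hx.2.1 j t)
  linarith [hx.earlyFreeProb_mul_late_le t k]

lemma LPFeasible.mean_earlyFree_mul_le (hx : LPFeasible m n p x) (t : Fin n) {i j : Fin m}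
    (hij : i ≠ j) :
    mean p x (fun cfg => (1 - earlyFree x t i cfg) *
        (firstPick j (sliceEquiv cfg t) - hit j (sliceEquiv cfg t) * earlyFree x t j cfg)) ≤
      x j t * ((1 - earlyFreeProb p x t i) * (1 - q m n x j t * earlyFreeProb p x t j)) := by
  have h1 := hx.mean_mul_prod (firstPick j) (fun _ _ => 1) t rfl
  have h2 := hx.mean_mul_prod (firstPick j) (avoidsEarly x t i) t (avoidsEarly_self t i)
  have h3 := hx.mean_mul_prod (hit j) (avoidsEarly x t j) t (avoidsEarly_self t j)
  have h4 := hx.mean_mul_prod (hit j)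
    (fun s σ => avoidsEarly x t i s σ * avoidsEarly x t j s σ) t
    (by simp [avoidsEarly_self])
  have h5 : ∏ s, sliceMean p x s (fun σ => avoidsEarly x t i s σ * avoidsEarly x t j s σ) ≤
      earlyFreeProb p x t i * earlyFreeProb p x t j := by
    simp only [earlyFreeProb, ← prod_mul_distrib]
    exact prod_le_prod (fun s _ => hx.sliceMean_nonneg s fun σ =>
      mul_nonneg (avoidsEarly_nonneg t i s σ) (avoidsEarly_nonneg t j s σ))
      fun s _ => hx.sliceMean_avoidsEarly_mul_le t hij s
  simp only [hx.sliceMean_one, hx.sliceMean_firstPick, hx.sliceMean_hit, prod_const_one,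
    prod_mul_distrib, mul_one] at h1 h2 h3 h4
  have h6 : (fun cfg : Cfg m n => (1 - earlyFree x t i cfg) *
        (firstPick j (sliceEquiv cfg t) - hit j (sliceEquiv cfg t) * earlyFree x t j cfg)) =
      fun cfg => (firstPick j (sliceEquiv cfg t) -
        firstPick j (sliceEquiv cfg t) * earlyFree x t i cfg) -
        (hit j (sliceEquiv cfg t) * earlyFree x t j cfg -
        hit j (sliceEquiv cfg t) * (earlyFree x t i cfg * earlyFree x t j cfg)) := by
    funext cfg; ring
  rw [h6, mean_sub, mean_sub, mean_sub]
  simp only [earlyFree]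
  rw [h1, h2, h3, h4]
  have h7 := mul_le_mul_of_nonneg_left h5 (mul_nonneg (hx.2.1 j t) (hx.q_nonneg j t))
  unfold earlyFreeProb at *
  linarith

lemma LPFeasible.mean_firstPick_sub (hx : LPFeasible m n p x) (t : Fin n) (j : Fin m) :
    mean p x (fun cfg => firstPick j (sliceEquiv cfg t) -
        hit j (sliceEquiv cfg t) * earlyFree x t j cfg) =
      x j t * (1 - q m n x j t * earlyFreeProb p x t j) := by
  have h1 := hx.mean_mul_prod (firstPick j) (fun _ _ => 1) t rfl
  have h3 := hx.mean_mul_prod (hit j) (avoidsEarly x t j) t (avoidsEarly_self t j)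
  simp only [hx.sliceMean_one, hx.sliceMean_firstPick, hx.sliceMean_hit, prod_const_one,
    mul_one] at h1 h3
  rw [mean_sub]
  simp only [earlyFree]
  rw [h1, h3, earlyFreeProb]
  ring

lemma LPFeasible.mean_one_sub_earlyFree (hx : LPFeasible m n p x) (t : Fin n) (i : Fin m) :
    mean p x (fun cfg => 1 - earlyFree x t i cfg) = 1 - earlyFreeProb p x t i := by
  have h1 := mean_prod (p := p) (x := x) (fun _ _ => 1)
  simp only [hx.sliceMean_one, prod_const_one] at h1
  rw [mean_sub, h1]
  exact congrArg _ (mean_prod _)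

end Slices

section Matching

variable {m n} {x : Fin m → Fin n → ℝ}

lemma proc_subset_succ (cfg : Cfg m n) (u : ℕ) :
    (proc m n x cfg u).1 ∪ (proc m n x cfg u).2 ⊆
      (proc m n x cfg (u + 1)).1 ∪ (proc m n x cfg (u + 1)).2 := by
  rw [proc]
  dsimp only
  split_ifs
  · exact union_subset_union_left (subset_insert _ _)
  · exact union_subset_union_right (subset_insert _ _)
  · exact Subset.rfl
  · exact Subset.rfl

lemma snd_lt_of_mem_proc_fst {cfg : Cfg m n} {u : ℕ} {e : Fin m × Fin n}
    (h : e ∈ (proc m n x cfg u).1) : e.2.1 < u := by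
  induction u with
  | zero => simp [proc] at h
  | succ u ih =>
    rw [proc] at h
    dsimp only at h
    split_ifs at h
    · rcases mem_insert.1 h with rfl | h
      · exact Nat.lt_succ_self u
      · exact (ih h).trans (Nat.lt_succ_self u)
    all_goals exact (ih h).trans (Nat.lt_succ_self u)

lemma mem_U1_iff (cfg : Cfg m n) (t : Fin n) :
    cfg ∈ U1 m n x t ↔
      ¬(cfg.1 t = true ∧ cfg ∈ V m n x (cfg.2.1 t) t ∧ cfg.2.2.2 (cfg.2.1 t) t = true) := by
  have hlt : ∀ k, (k, t) ∉ (proc m n x cfg t.1).1 := fun k h =>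
    lt_irrefl _ (snd_lt_of_mem_proc_fst h)
  simp only [U1, Set.mem_ofPred_eq, V]
  rw [proc]
  simp only [t.2, dite_true, Fin.eta]
  split_ifs with h1 h2
  · simp only [h1, and_self, not_true, iff_false, not_forall, not_not]
    exact ⟨_, mem_insert_self _ _⟩
  · simp [h1, hlt]
  · simp [h1, hlt]

lemma not_hit_of_freeBin {cfg : Cfg m n} {k : Fin m} {u : ℕ}
    (h : FreeBin m n ((proc m n x cfg u).1 ∪ (proc m n x cfg u).2) k) {s : Fin n}
    (hs : s.1 < u) : ¬(cfg.1 s = true ∧ cfg.2.1 s = k ∧ cfg.2.2.2 k s = true) := by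
  induction u with
  | zero => exact absurd hs (Nat.not_lt_zero _)
  | succ u ih =>
    have hu : FreeBin m n ((proc m n x cfg u).1 ∪ (proc m n x cfg u).2) k :=
      fun r hr => h r (proc_subset_succ cfg u hr)
    rcases Nat.lt_succ_iff_lt_or_eq.1 hs with hs | rfl
    · exact ih hu hs
    · rintro ⟨ha, rfl, hy⟩
      refine h s ?_
      rw [proc]
      simp only [s.2, dite_true, Fin.eta, ha, hu, hy, and_self, if_true]
      simp

lemma exists_pick_of_not_freeBin {cfg : Cfg m n} {k : Fin m} {u : ℕ}
    (h : ¬FreeBin m n ((proc m n x cfg u).1 ∪ (proc m n x cfg u).2) k) :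
    ∃ s : Fin n, s.1 < u ∧ cfg.1 s = true ∧
      (cfg.2.1 s = k ∧ cfg.2.2.2 k s = true ∨ cfg.2.2.1 s = k ∧ Late m n x k s) := by
  induction u with
  | zero => simp [FreeBin, proc] at h
  | succ u ih =>
    by_cases hu : FreeBin m n ((proc m n x cfg u).1 ∪ (proc m n x cfg u).2) k
    · simp only [FreeBin, not_forall, not_not] at h
      obtain ⟨r, hr⟩ := h
      rw [proc] at hr
      dsimp only at hr
      split_ifs at hr with hn h1 h2
      · rw [insert_union] at hr
        rcases mem_insert.1 hr with he | he
        · obtain rfl := (Prod.ext_iff.1 he).1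
          exact ⟨⟨u, hn⟩, Nat.lt_succ_self u, h1.1, Or.inl ⟨rfl, h1.2.2⟩⟩
        · exact absurd he (hu r)
      · rw [union_insert] at hr
        rcases mem_insert.1 hr with he | he
        · obtain rfl := (Prod.ext_iff.1 he).1
          exact ⟨⟨u, hn⟩, Nat.lt_succ_self u, h2.1, Or.inr ⟨rfl, h2.2.2⟩⟩
        · exact absurd he (hu r)
      · exact absurd hr (hu r)
      · exact absurd hr (hu r)
    · obtain ⟨s, hs, h⟩ := ih hu
      exact ⟨s, hs.trans (Nat.lt_succ_self u), h⟩

lemma earlyFree_eq_zero_or_one (t : Fin n) (k : Fin m) (cfg : Cfg m n) :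
    earlyFree x t k cfg = 0 ∨ earlyFree x t k cfg = 1 := by
  by_cases h : ∃ s, avoidsEarly x t k s (sliceEquiv cfg s) = 0
  · obtain ⟨s, hs⟩ := h
    exact Or.inl (prod_eq_zero (mem_univ s) hs)
  · refine Or.inr (prod_eq_one fun s _ => ?_)
    have hs : avoidsEarly x t k s (sliceEquiv cfg s) ≠ 0 := fun hs => h ⟨s, hs⟩
    unfold avoidsEarly at hs ⊢
    rw [hit_eq] at hs ⊢
    split_ifs at hs ⊢ <;> simp_all

lemma earlyFree_of_mem_V {t : Fin n} {k : Fin m} {cfg : Cfg m n} (h : cfg ∈ V m n x k t) :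
    earlyFree x t k cfg = 1 := by
  refine prod_eq_one fun s _ => ?_
  unfold avoidsEarly
  split_ifs with hs
  · have hh := not_hit_of_freeBin h (Fin.lt_def.1 hs.1)
    rw [hit_eq]
    exact (congrArg (1 - ·) (if_neg hh)).trans (sub_zero 1)
  · rfl

lemma firstPick_nonneg (k : Fin m) (σ : Slice m) : 0 ≤ firstPick k σ := by
  unfold firstPick; split_ifs <;> simp

lemma secondPick_nonneg (k : Fin m) (σ : Slice m) : 0 ≤ secondPick k σ := by
  unfold secondPick; split_ifs <;> simp

lemma earlyFree_nonneg (t : Fin n) (k : Fin m) (cfg : Cfg m n) : 0 ≤ earlyFree x t k cfg :=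
  prod_nonneg fun _ _ => avoidsEarly_nonneg _ _ _ _

lemma latePicks_nonneg (t : Fin n) (k : Fin m) (cfg : Cfg m n) : 0 ≤ latePicks x t k cfg :=
  sum_nonneg fun _ _ => mul_nonneg (add_nonneg (firstPick_nonneg _ _) (secondPick_nonneg _ _))
    (earlyFree_nonneg t k cfg)

lemma one_le_latePicks {t : Fin n} {k : Fin m} {cfg : Cfg m n} (hO : cfg ∈ O m n x k t)
    (hW : earlyFree x t k cfg = 1) : 1 ≤ latePicks x t k cfg := by
  obtain ⟨s, hst, ha, h⟩ := exists_pick_of_not_freeBin hO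
  have hlate : Late m n x k s := by
    rcases h with ⟨h1, hy⟩ | h
    · intro hE
      refine one_ne_zero (hW.symm.trans (prod_eq_zero (mem_univ s) ?_))
      rw [avoidsEarly, if_pos ⟨Fin.lt_def.2 hst, hE⟩, hit_eq, if_pos ⟨ha, h1, hy⟩, sub_self]
    · exact h.2
  have hpick : 1 ≤ firstPick k (sliceEquiv cfg s) + secondPick k (sliceEquiv cfg s) := by
    rcases h with h | h
    · have h1 : firstPick k (sliceEquiv cfg s) = 1 := by simp [firstPick, sliceEquiv, ha, h.1]
      linarith [secondPick_nonneg k (sliceEquiv cfg s)]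
    · have h1 : secondPick k (sliceEquiv cfg s) = 1 := by simp [secondPick, sliceEquiv, ha, h.1]
      linarith [firstPick_nonneg k (sliceEquiv cfg s)]
  have hmem : s ∈ univ.filter fun s => s < t ∧ Late m n x k s := by
    simpa using ⟨Fin.lt_def.2 hst, hlate⟩
  have hle := single_le_sum (f := fun s => (firstPick k (sliceEquiv cfg s) +
      secondPick k (sliceEquiv cfg s)) * earlyFree x t k cfg)
    (fun r _ => mul_nonneg (add_nonneg (firstPick_nonneg _ _) (secondPick_nonneg _ _))
      (earlyFree_nonneg t k cfg))
    hmem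
  refine le_trans ?_ hle
  simpa [hW] using hpick

/-- The event that ball `t` arrives, first-picks `j`, and is rejected. -/
def rejected (x : Fin m → Fin n → ℝ) (j : Fin m) (t : Fin n) : Set (Cfg m n) :=
  EvA m n t ∩ EvI1 m n j t ∩ U1 m n x t

lemma hit_eq_firstPick_or_zero (j : Fin m) (σ : Slice m) :
    hit j σ = firstPick j σ ∨ hit j σ = 0 := by
  unfold hit; split_ifs <;> simp

lemma rejected_occupied_le (i j : Fin m) (t : Fin n) (cfg : Cfg m n) :
    (if cfg ∈ O m n x i t ∩ rejected x j t then (1 : ℝ) else 0) ≤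
      (1 - earlyFree x t i cfg) *
        (firstPick j (sliceEquiv cfg t) - hit j (sliceEquiv cfg t) * earlyFree x t j cfg) +
      (firstPick j (sliceEquiv cfg t) * latePicks x t i cfg +
        firstPick j (sliceEquiv cfg t) * latePicks x t j cfg) := by
  have hi := latePicks_nonneg (x := x) t i cfg
  have hj := latePicks_nonneg (x := x) t j cfg
  have hf := firstPick_nonneg j (sliceEquiv cfg t)
  split_ifs with h
  · obtain ⟨hO, ⟨hA, hI⟩, hU⟩ := h
    simp only [EvA, EvI1, Set.mem_ofPred_eq] at hA hI
    have h1 : firstPick j (sliceEquiv cfg t) = 1 := by simp [firstPick, sliceEquiv, hA, hI]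
    rw [h1]
    rcases earlyFree_eq_zero_or_one (x := x) t i cfg with hWi | hWi
    · rcases earlyFree_eq_zero_or_one (x := x) t j cfg with hWj | hWj
      · rw [hWi, hWj]; linarith
      · rw [mem_U1_iff, hI] at hU
        by_cases hy : cfg.2.2.2 j t = true
        · have := one_le_latePicks (fun hV => hU ⟨hA, hV, hy⟩) hWj
          have : hit j (sliceEquiv cfg t) ≤ 1 := hit_le_one _ _
          rw [hWi, hWj]; linarith
        · have : hit j (sliceEquiv cfg t) = 0 := by simp [hit, sliceEquiv, hy]
          rw [hWi, this]; linarith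
    · have := one_le_latePicks hO hWi
      rw [hWi]; linarith
  · refine add_nonneg (mul_nonneg ?_ ?_) (add_nonneg (mul_nonneg hf hi) (mul_nonneg hf hj))
    · rcases earlyFree_eq_zero_or_one (x := x) t i cfg with hW | hW <;> simp [hW]
    · rcases earlyFree_eq_zero_or_one (x := x) t j cfg with hW | hW <;>
      rcases hit_eq_firstPick_or_zero j (sliceEquiv cfg t) with hh | hh <;> simp [hW, hh, hf]

lemma le_rejected (j : Fin m) (t : Fin n) (cfg : Cfg m n) :
    firstPick j (sliceEquiv cfg t) - hit j (sliceEquiv cfg t) * earlyFree x t j cfg ≤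
      if cfg ∈ rejected x j t then 1 else 0 := by
  by_cases h : cfg.1 t = true ∧ cfg.2.1 t = j
  · have h1 : firstPick j (sliceEquiv cfg t) = 1 := by simp [firstPick, sliceEquiv, h]
    split_ifs with hR
    · have := mul_nonneg (hit_nonneg j (sliceEquiv cfg t)) (earlyFree_nonneg (x := x) t j cfg)
      linarith
    · have hU : cfg ∉ U1 m n x t := fun hU => hR ⟨⟨h.1, h.2⟩, hU⟩
      rw [mem_U1_iff, not_not, h.2] at hU
      have hh : hit j (sliceEquiv cfg t) = 1 := by
        rw [hit_eq]; exact if_pos ⟨h.1, h.2, hU.2.2⟩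
      rw [h1, hh, earlyFree_of_mem_V hU.2.1]
      norm_num
  · have h1 : firstPick j (sliceEquiv cfg t) = 0 := by
      rw [not_and_or] at h
      rcases h with h | h <;> simp [firstPick, sliceEquiv, h]
    rw [hit, h1]
    split_ifs <;> simp

lemma one_sub_earlyFree_le (i : Fin m) (t : Fin n) (cfg : Cfg m n) :
    1 - earlyFree x t i cfg ≤ if cfg ∈ O m n x i t then 1 else 0 := by
  split_ifs with h
  · linarith [earlyFree_nonneg (x := x) t i cfg]
  · rw [earlyFree_of_mem_V (not_not.1 h), sub_self]

variable {p : Fin n → ℝ}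

lemma LPFeasible.Pr_nonneg (hx : LPFeasible m n p x) (E : Set (Cfg m n)) :
    0 ≤ Pr m n p x E := by
  rw [Pr_eq_mean]
  refine le_of_eq_of_le ?_ (hx.mean_mono (f := fun _ => 0) fun cfg => ?_)
  · simp [mean]
  · split_ifs <;> simp

lemma Pr_inter_rejection (E : Set (Cfg m n)) (i : Fin m) (t : Fin n) :
    Pr m n p x (E ∩ (EvA m n t ∩ {cfg | cfg.2.1 t ≠ i} ∩ U1 m n x t)) =
      ∑ j ∈ univ.erase i, Pr m n p x (E ∩ rejected x j t) := by
  simp only [Pr_eq_mean]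
  rw [← mean_sum]
  refine congrArg _ (funext fun cfg => ?_)
  have h : ∑ j ∈ univ.erase i, (if cfg ∈ E ∩ rejected x j t then (1 : ℝ) else 0) =
      ∑ j ∈ univ.erase i,
        if cfg.2.1 t = j then (if cfg ∈ E ∩ (EvA m n t ∩ U1 m n x t) then 1 else 0) else 0 := by
    refine sum_congr rfl fun j _ => ?_
    rw [← ite_and]
    refine if_congr ?_ rfl rfl
    simp only [rejected, EvI1, Set.mem_inter_iff, Set.mem_ofPred_eq]
    tauto
  refine Eq.trans ?_ h.symm
  rw [sum_ite_eq, ← ite_and]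
  refine if_congr ?_ rfl rfl
  simp only [Set.mem_inter_iff, Set.mem_ofPred_eq, mem_erase, mem_univ]
  tauto

lemma LPFeasible.Pr_occupied_rejected_le (hx : LPFeasible m n p x) {i j : Fin m} (hij : i ≠ j)
    {t : Fin n} (hlate : Late m n x i t) :
    Pr m n p x (O m n x i t ∩ rejected x j t) ≤
      Pr m n p x (O m n x i t) * (1 + 12 * c / (1 / 2 - c) ^ 2) * Pr m n p x (rejected x j t) := by
  have h1 := hx.mean_mono (rejected_occupied_le (x := x) i j t)
  have h2 := hx.mean_mono (le_rejected (x := x) j t)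
  have h3 := hx.mean_mono (one_sub_earlyFree_le (x := x) i t)
  rw [← Pr_eq_mean, mean_add, mean_add] at h1
  rw [← Pr_eq_mean, hx.mean_firstPick_sub] at h2
  rw [← Pr_eq_mean, hx.mean_one_sub_earlyFree] at h3
  have h4 := hx.mean_earlyFree_mul_le t hij
  have h5 := hx.mean_mul_latePicks_le t j i
  have h6 := hx.mean_mul_latePicks_le t j j
  have h7 := hx.earlyFreeProb_le_of_late le_rfl hlate
  have h8 := hx.q_mul_earlyFreeProb_le t j
  have h9 := hx.2.1 j t
  generalize Pr m n p x (O m n x i t) = P at *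
  generalize Pr m n p x (rejected x j t) = R at *
  generalize earlyFreeProb p x t i = w at *
  generalize q m n x j t * earlyFreeProb p x t j = v at *
  generalize x j t = y at *
  have hw : 1 / 2 - c ≤ 1 - w := by linarith
  have hv : 1 / 2 - c ≤ 1 - v := by linarith
  have hc : 0 < 1 / 2 - c := by norm_num [c]
  have hc' : 0 < c := by norm_num [c]
  have hPR : (1 - w) * (y * (1 - v)) ≤ P * R :=
    mul_le_mul h3 h2 (mul_nonneg h9 (hc.le.trans hv)) ((hc.le.trans hw).trans h3)
  have hK : 0 ≤ 12 * c / (1 / 2 - c) ^ 2 := by positivity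
  have hwv : (1 / 2 - c) ^ 2 ≤ (1 - w) * (1 - v) := by
    rw [sq]; exact mul_le_mul hw hv hc.le (hc.le.trans hw)
  have hmass : 12 * c ≤ 12 * c / (1 / 2 - c) ^ 2 * ((1 - w) * (1 - v)) := by
    calc 12 * c = 12 * c / (1 / 2 - c) ^ 2 * (1 / 2 - c) ^ 2 :=
        (div_mul_cancel₀ _ (pow_pos hc 2).ne').symm
      _ ≤ _ := mul_le_mul_of_nonneg_left hwv hK
  calc _ ≤ y * ((1 - w) * (1 - v)) + (y * (4 * c) + y * (4 * c)) := by linarith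
    _ ≤ y * ((1 - w) * (1 - v)) + y * (12 * c) := by linarith [mul_nonneg h9 hc'.le]
    _ ≤ y * ((1 - w) * (1 - v)) + y * (12 * c / (1 / 2 - c) ^ 2 * ((1 - w) * (1 - v))) := by
      linarith [mul_le_mul_of_nonneg_left hmass h9]
    _ = (1 + 12 * c / (1 / 2 - c) ^ 2) * ((1 - w) * (y * (1 - v))) := by ring
    _ ≤ (1 + 12 * c / (1 / 2 - c) ^ 2) * (P * R) :=
      mul_le_mul_of_nonneg_left hPR (by linarith)
    _ = _ := by ring

end Matching

/-- in the rounding process with LP-feasible `x`, for every late edge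
`(i,t)` (so that the conditioning event has positive probability),
`P[O_{i,t} | A_t = 1, I¹_t ≠ i, U₁(t)] ≤ P[O_{i,t}] · (1 + 12c/(1/2 − c)²)`. -/
theorem occupancy_conditioned_on_rejection (p : Fin n → ℝ) (x : Fin m → Fin n → ℝ)
    (hx : LPFeasible m n p x) (i : Fin m) (t : Fin n) (hlate : Late m n x i t) :
    condPr m n p x (O m n x i t)
        (EvA m n t ∩ {cfg | cfg.2.1 t ≠ i} ∩ U1 m n x t) ≤
      Pr m n p x (O m n x i t) * (1 + 12 * c / (1/2 - c) ^ 2) := by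
  have hK : 0 ≤ 1 + 12 * c / (1 / 2 - c) ^ 2 := by norm_num [c]
  have hF := Pr_inter_rejection (p := p) (x := x) Set.univ i t
  simp only [Set.univ_inter] at hF
  refine div_le_of_le_mul₀ (hx.Pr_nonneg _) (mul_nonneg (hx.Pr_nonneg _) hK) ?_
  rw [Pr_inter_rejection, hF, mul_sum]
  exact sum_le_sum fun j hj => hx.Pr_occupied_rejected_le (ne_of_mem_erase hj).symm hlate

end Rounding
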